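/- arXiv:1901.06074 — 3 statements merged into one kernel-verified Lean document; each statement's English description precedes it below -/
import Mathlib

section
/- Let n ∈ ℕ, n ≥ 1, and let b^{jk}, ℓ, v, 𝒜 : ℝⁿ → ℝ (1 ≤ j,k ≤ n) be smooth functions with b^{jk} = b^{kj}. Then at every point of ℝⁿ: 2 Σ_{j,k=1}^n b^{jk} ℓ_{x_j} v_{x_k} · ( − Σ_{j,k=1}^n (b^{jk} v_{x_j})_{x_k} + 𝒜 v ) = − Σ_{k=1}^n ∂_{x_k} [ Σ_{j=1}^n ( Σ_{j',k'=1}^n ( 2 b^{jk} b^{j'k'} ℓ_{x_{j'}} v_{x_j} v_{x_{k'}} − b^{jk} b^{j'k'} ℓ_{x_j} v_{x_{j'}} v_{x_{k'}} ) − 𝒜 b^{jk} ℓ_{x_j} v² ) ] + Σ_{j,k=1}^n Σ_{j',k'=1}^n [ 2 b^{jk'} (b^{j'k} ℓ_{x_{j'}})_{x_{k'}} − (b^{jk} b^{j'k'} ℓ_{x_{j'}})_{x_{k'}} ] v_{x_j} v_{x_k} − Σ_{j,k=1}^n (𝒜 b^{jk} ℓ_{x_j})_{x_k} v². -/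
open scoped BigOperators

/-- Partial derivative in the `j`-th coordinate of `ℝⁿ`. -/
noncomputable def pd {n : ℕ} (j : Fin n) (f : (Fin n → ℝ) → ℝ) : (Fin n → ℝ) → ℝ :=
  fun x => fderiv ℝ f x (Pi.single j 1)

lemma pd_mul' {n : ℕ} (i : Fin n) {f g : (Fin n → ℝ) → ℝ} (hf : Differentiable ℝ f)
    (hg : Differentiable ℝ g) (x : Fin n → ℝ) :
    pd i (fun y => f y * g y) x = pd i f x * g x + f x * pd i g x := by
  unfold pd
  rw [fderiv_fun_mul (hf x) (hg x)]
  simp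
  ring

lemma pd_sub' {n : ℕ} (i : Fin n) {f g : (Fin n → ℝ) → ℝ} (hf : Differentiable ℝ f)
    (hg : Differentiable ℝ g) (x : Fin n → ℝ) :
    pd i (fun y => f y - g y) x = pd i f x - pd i g x := by
  unfold pd
  rw [fderiv_fun_sub (hf x) (hg x)]
  simp

lemma pd_const' {n : ℕ} (i : Fin n) (c : ℝ) (x : Fin n → ℝ) :
    pd i (fun _ => c) x = 0 := by
  unfold pd
  simp

lemma pd_sum' {n : ℕ} (i : Fin n) {f : Fin n → (Fin n → ℝ) → ℝ}
    (hf : ∀ j, Differentiable ℝ (f j)) (x : Fin n → ℝ) :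
    pd i (fun y => ∑ j, f j y) x = ∑ j, pd i (f j) x := by
  unfold pd
  rw [fderiv_fun_sum (fun j _ => hf j x)]
  simp

lemma pd_smooth {n : ℕ} (i : Fin n) {f : (Fin n → ℝ) → ℝ} (hf : ContDiff ℝ (⊤ : ℕ∞) f) :
    ContDiff ℝ (⊤ : ℕ∞) (pd i f) := by
  unfold pd
  exact (hf.fderiv_right (m := ((⊤ : ℕ∞) : WithTop ℕ∞)) (by simp)).clm_apply contDiff_const

lemma pd_comm' {n : ℕ} (i j : Fin n) {f : (Fin n → ℝ) → ℝ} (hf : ContDiff ℝ (⊤ : ℕ∞) f)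
    (x : Fin n → ℝ) : pd i (pd j f) x = pd j (pd i f) x := by
  have hd : DifferentiableAt ℝ (fderiv ℝ f) x :=
    ((hf.fderiv_right (m := ((⊤ : ℕ∞) : WithTop ℕ∞)) (by simp)).differentiable (by simp)) x
  have key : ∀ a c : Fin n, pd a (pd c f) x
      = fderiv ℝ (fderiv ℝ f) x (Pi.single a 1) (Pi.single c 1) := by
    intro a c
    unfold pd
    rw [fderiv_clm_apply hd (differentiableAt_const _)]
    simp
  rw [key, key]
  exact (hf.contDiffAt.isSymmSndFDerivAt (by simp only [minSmoothness_of_isRCLikeNormedField]; exact WithTop.coe_le_coe.2 le_top)) _ _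

/-- The pointwise divergence identity (1c1.3) used in the derivation of the fundamental
Carleman identity for stochastic hyperbolic-like operators. -/
theorem stmt2 (n : ℕ) (hn : 1 ≤ n)
    (b : Fin n → Fin n → (Fin n → ℝ) → ℝ)
    (hb : ∀ j k, ContDiff ℝ (⊤ : ℕ∞) (b j k))
    (hbsym : ∀ j k, b j k = b k j)
    (ℓ v A : (Fin n → ℝ) → ℝ)
    (hℓ : ContDiff ℝ (⊤ : ℕ∞) ℓ) (hv : ContDiff ℝ (⊤ : ℕ∞) v) (hA : ContDiff ℝ (⊤ : ℕ∞) A) :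
    ∀ x : Fin n → ℝ,
      2 * (∑ j, ∑ k, b j k x * pd j ℓ x * pd k v x)
          * (-(∑ j, ∑ k, pd k (fun y => b j k y * pd j v y) x) + A x * v x)
        = -(∑ k, pd k (fun y => ∑ j,
              ((∑ j', ∑ k',
                  (2 * b j k y * b j' k' y * pd j' ℓ y * pd j v y * pd k' v y
                    - b j k y * b j' k' y * pd j ℓ y * pd j' v y * pd k' v y))
                - A y * b j k y * pd j ℓ y * v y ^ 2)) x)
          + (∑ j, ∑ k, (∑ j', ∑ k',
              (2 * b j k' x * pd k' (fun y => b j' k y * pd j' ℓ y) x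
                - pd k' (fun y => b j k y * b j' k' y * pd j' ℓ y) x))
              * pd j v x * pd k v x)
          - ∑ j, ∑ k, pd k (fun y => A y * b j k y * pd j ℓ y) x * v x ^ 2 := by
  intro x
  have sd : ∀ {f : (Fin n → ℝ) → ℝ}, ContDiff ℝ (⊤ : ℕ∞) f → Differentiable ℝ f :=
    fun h => h.differentiable (by simp)
  have dA := sd hA
  have dv := sd hv
  have db : ∀ j k, Differentiable ℝ (b j k) := fun j k => sd (hb j k)
  have dpv : ∀ j, Differentiable ℝ (pd j v) := fun j => sd (pd_smooth j hv)
  have dpl : ∀ j, Differentiable ℝ (pd j ℓ) := fun j => sd (pd_smooth j hℓ)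
  obtain ⟨L, hL⟩ : ∃ L : Fin n → (Fin n → ℝ) → ℝ,
      L = fun k y => ∑ j, b j k y * pd j ℓ y := ⟨_, rfl⟩
  obtain ⟨w, hw⟩ : ∃ w : Fin n → (Fin n → ℝ) → ℝ,
      w = fun k y => ∑ j, b j k y * pd j v y := ⟨_, rfl⟩
  obtain ⟨P, hP⟩ : ∃ P : (Fin n → ℝ) → ℝ, P = fun y => ∑ k, L k y * pd k v y := ⟨_, rfl⟩
  obtain ⟨Q, hQ⟩ : ∃ Q : (Fin n → ℝ) → ℝ,
      Q = fun y => ∑ j, ∑ k, b j k y * pd j v y * pd k v y := ⟨_, rfl⟩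
  have dL : ∀ k, Differentiable ℝ (L k) := by
    intro k; rw [hL]; fun_prop
  have dw : ∀ k, Differentiable ℝ (w k) := by
    intro k; rw [hw]; fun_prop
  have dP : Differentiable ℝ P := by rw [hP]; fun_prop
  have dQ : Differentiable ℝ Q := by rw [hQ]; fun_prop
  have ePd : ∀ y, (∑ j, ∑ k, b j k y * pd j ℓ y * pd k v y) = P y := by
    intro y
    rw [Finset.sum_comm, hP, hL]
    simp only [Finset.sum_mul]
  have e2 : (∑ j, ∑ k, pd k (fun y => b j k y * pd j v y) x) = ∑ k, pd k (w k) x := by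
    rw [Finset.sum_comm]
    refine Finset.sum_congr rfl fun k _ => ?_
    rw [hw]
    exact (pd_sum' k (fun j => (db j k).mul (dpv j)) x).symm
  have e3 : ∀ k, (fun y => ∑ j,
              ((∑ j', ∑ k',
                  (2 * b j k y * b j' k' y * pd j' ℓ y * pd j v y * pd k' v y
                    - b j k y * b j' k' y * pd j ℓ y * pd j' v y * pd k' v y))
                - A y * b j k y * pd j ℓ y * v y ^ 2))
      = fun y => (2 * w k y) * P y - L k y * Q y - (A y * L k y) * (v y * v y) := by
    intro k
    funext y
    rw [Finset.sum_sub_distrib]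
    simp only [Finset.sum_sub_distrib]
    congr 1
    · congr 1
      · rw [← ePd y, hw]
        simp only []
        rw [Finset.mul_sum (a := (2 : ℝ)), Finset.sum_mul]
        refine Finset.sum_congr rfl fun j _ => ?_
        simp only [Finset.mul_sum]
        refine Finset.sum_congr rfl fun j' _ => Finset.sum_congr rfl fun k' _ => ?_
        ring
      · rw [hQ, hL]
        simp only [Finset.sum_mul]
        refine Finset.sum_congr rfl fun j _ => ?_
        simp only [Finset.mul_sum]
        refine Finset.sum_congr rfl fun j' _ => Finset.sum_congr rfl fun k' _ => ?_
        ring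
    · rw [hL]
      simp only [Finset.mul_sum, Finset.sum_mul]
      refine Finset.sum_congr rfl fun j _ => ?_
      ring
  have e4 : ∀ j k, (∑ j', ∑ k',
              (2 * b j k' x * pd k' (fun y => b j' k y * pd j' ℓ y) x
                - pd k' (fun y => b j k y * b j' k' y * pd j' ℓ y) x))
      = ∑ i, (2 * b j i x * pd i (L k) x
          - (pd i (b j k) x * L i x + b j k x * pd i (L i) x)) := by
    intro j k
    rw [Finset.sum_comm]
    refine Finset.sum_congr rfl fun i _ => ?_
    rw [← pd_mul' i (db j k) (dL i), Finset.sum_sub_distrib, ← Finset.mul_sum]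
    congr 1
    · rw [hL]
      exact congrArg _ (pd_sum' i (fun j' => (db j' k).mul (dpl j')) x).symm
    · rw [← pd_sum' i (f := fun j' y => b j k y * b j' i y * pd j' ℓ y) (fun j' => ((db j k).mul (db j' i)).mul (dpl j')) x]
      rw [hL]
      congr 1
      funext y
      simp [Finset.mul_sum, mul_assoc]
  have e5 : (∑ j, ∑ k, pd k (fun y => A y * b j k y * pd j ℓ y) x * v x ^ 2)
      = ∑ k, pd k (fun y => A y * L k y) x * v x ^ 2 := by
    rw [Finset.sum_comm]
    refine Finset.sum_congr rfl fun k _ => ?_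
    rw [← Finset.sum_mul]
    congr 1
    rw [← pd_sum' k (f := fun j y => A y * b j k y * pd j ℓ y) (fun j => (dA.mul (db j k)).mul (dpl j)) x]
    rw [hL]
    congr 1
    funext y
    simp [Finset.mul_sum, mul_assoc]
  have e6 : ∀ k, pd k P x = ∑ m, (pd k (L m) x * pd m v x + L m x * pd k (pd m v) x) := by
    intro k
    rw [hP, pd_sum' k (f := fun m y => L m y * pd m v y) (fun m => (dL m).mul (dpv m)) x]
    exact Finset.sum_congr rfl fun m _ => pd_mul' k (dL m) (dpv m) x
  have e7 : ∀ k, pd k Q x = (∑ i, ∑ j, pd k (b i j) x * pd i v x * pd j v x)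
      + 2 * ∑ m, w m x * pd k (pd m v) x := by
    intro k
    have h1 : pd k Q x = ∑ i, ∑ j, (pd k (b i j) x * pd i v x * pd j v x
        + b i j x * pd k (pd i v) x * pd j v x + b i j x * pd i v x * pd k (pd j v) x) := by
      rw [hQ, pd_sum' k (f := fun i y => ∑ j, b i j y * pd i v y * pd j v y)
        (fun i => by fun_prop) x]
      refine Finset.sum_congr rfl fun i _ => ?_
      rw [pd_sum' k (f := fun j y => b i j y * pd i v y * pd j v y) (fun j => ((db i j).mul (dpv i)).mul (dpv j)) x]
      refine Finset.sum_congr rfl fun j _ => ?_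
      rw [pd_mul' k (f := fun y => b i j y * pd i v y) ((db i j).mul (dpv i)) (dpv j) x, pd_mul' k (db i j) (dpv i) x]
      ring
    rw [h1]
    simp only [Finset.sum_add_distrib]
    have h2 : (∑ i, ∑ j, b i j x * pd i v x * pd k (pd j v) x)
        = ∑ m, w m x * pd k (pd m v) x := by
      rw [Finset.sum_comm, hw]
      simp only [Finset.sum_mul]
    have h3 : (∑ i, ∑ j, b i j x * pd k (pd i v) x * pd j v x)
        = ∑ m, w m x * pd k (pd m v) x := by
      rw [hw]
      simp only [Finset.sum_mul]
      refine Finset.sum_congr rfl fun i _ => Finset.sum_congr rfl fun j _ => ?_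
      rw [hbsym i j]
      ring
    rw [h2, h3]
    ring
  have e8 : ∀ k, pd k (fun y => (2 * w k y) * P y - L k y * Q y - (A y * L k y) * (v y * v y)) x
      = 2 * pd k (w k) x * P x + 2 * w k x * pd k P x - (pd k (L k) x * Q x + L k x * pd k Q x)
        - (pd k (fun y => A y * L k y) x * v x ^ 2 + A x * L k x * (2 * v x * pd k v x)) := by
    intro k
    have dk := dL k
    have dwk := dw k
    rw [pd_sub' k (by fun_prop) (by fun_prop), pd_sub' k (by fun_prop) (by fun_prop),
      pd_mul' k (f := fun y => 2 * w k y) (by fun_prop) dP, pd_mul' k dk dQ,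
      pd_mul' k (f := fun y => A y * L k y) (g := fun y => v y * v y) (by fun_prop) (by fun_prop),
      pd_mul' k dv dv, pd_mul' k (f := fun _ => 2) (by fun_prop) dwk, pd_const']
    ring
  have e9 : (∑ k, w k x * ∑ m, L m x * pd k (pd m v) x)
      = ∑ k, L k x * ∑ m, w m x * pd k (pd m v) x := by
    simp only [Finset.mul_sum]
    rw [Finset.sum_comm]
    refine Finset.sum_congr rfl fun i _ => Finset.sum_congr rfl fun j _ => ?_
    rw [pd_comm' i j hv x]
    ring
  -- the quadratic form
  have e10 : (∑ j, ∑ k, (∑ i, (2 * b j i x * pd i (L k) x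
          - (pd i (b j k) x * L i x + b j k x * pd i (L i) x))) * pd j v x * pd k v x)
      = 2 * (∑ k, w k x * ∑ m, pd k (L m) x * pd m v x)
        - (∑ k, L k x * ∑ i, ∑ j, pd k (b i j) x * pd i v x * pd j v x)
        - ∑ k, pd k (L k) x * Q x := by
    have a1 : (∑ k, w k x * ∑ m, pd k (L m) x * pd m v x)
        = ∑ j, ∑ k, ∑ i, b j i x * pd i (L k) x * pd j v x * pd k v x := by
      rw [hw]
      simp only [Finset.mul_sum, Finset.sum_mul]
      rw [Finset.sum_congr rfl fun i _ => Finset.sum_comm, Finset.sum_comm]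
      refine Finset.sum_congr rfl fun j _ => ?_
      rw [Finset.sum_comm]
      refine Finset.sum_congr rfl fun k _ => Finset.sum_congr rfl fun i _ => ?_
      ring
    have a2 : (∑ k, L k x * ∑ i, ∑ j, pd k (b i j) x * pd i v x * pd j v x)
        = ∑ j, ∑ k, ∑ i, pd i (b j k) x * L i x * pd j v x * pd k v x := by
      simp only [Finset.mul_sum]
      rw [Finset.sum_comm]
      refine Finset.sum_congr rfl fun j _ => ?_
      rw [Finset.sum_comm]
      refine Finset.sum_congr rfl fun k _ => Finset.sum_congr rfl fun i _ => ?_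
      ring
    have a3 : (∑ k, pd k (L k) x * Q x)
        = ∑ j, ∑ k, ∑ i, b j k x * pd i (L i) x * pd j v x * pd k v x := by
      rw [hQ]
      simp only [Finset.mul_sum]
      rw [Finset.sum_comm]
      refine Finset.sum_congr rfl fun j _ => ?_
      rw [Finset.sum_comm]
      refine Finset.sum_congr rfl fun k _ => Finset.sum_congr rfl fun i _ => ?_
      ring
    rw [a1, a2, a3]
    simp only [Finset.mul_sum, Finset.sum_mul, ← Finset.sum_sub_distrib]
    refine Finset.sum_congr rfl fun j _ => Finset.sum_congr rfl fun k _ =>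
      Finset.sum_congr rfl fun i _ => ?_
    ring
  have e11 : (∑ k, pd k (fun y => (2 * w k y) * P y - L k y * Q y
        - (A y * L k y) * (v y * v y)) x)
      = 2 * (∑ k, pd k (w k) x) * P x
        + 2 * (∑ k, w k x * ∑ m, pd k (L m) x * pd m v x)
        + 2 * (∑ k, w k x * ∑ m, L m x * pd k (pd m v) x)
        - (∑ k, pd k (L k) x * Q x)
        - (∑ k, L k x * ∑ i, ∑ j, pd k (b i j) x * pd i v x * pd j v x)
        - 2 * (∑ k, L k x * ∑ m, w m x * pd k (pd m v) x)
        - (∑ k, pd k (fun y => A y * L k y) x * v x ^ 2)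
        - 2 * A x * v x * P x := by
    have hPx : 2 * A x * v x * P x = ∑ k, 2 * A x * v x * (L k x * pd k v x) := by
      rw [hP, Finset.mul_sum]
    rw [hPx, mul_assoc 2 _ (P x), Finset.sum_mul, Finset.mul_sum, Finset.mul_sum, Finset.mul_sum,
      Finset.mul_sum]
    simp only [← Finset.sum_sub_distrib, ← Finset.sum_add_distrib]
    refine Finset.sum_congr rfl fun k _ => ?_
    rw [e8, e6, e7, Finset.sum_add_distrib]
    ring
  rw [ePd x, e2]
  simp only [e3, e4]
  rw [e5, e10, e11, e9]
  ring
end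

section
/- Let n ∈ ℕ, n ≥ 1, and let b^{jk}, ℓ, Ψ, v : ℝ × ℝⁿ → ℝ (1 ≤ j,k ≤ n) be smooth functions with b^{jk} = b^{kj}. Then at every point (t,x) ∈ ℝ × ℝⁿ: ( − 2 ℓ_t v_t + 2 Σ_{j,k=1}^n b^{jk} ℓ_{x_j} v_{x_k} + Ψ v ) · v_{tt} = ∂_t ( − ℓ_t v_t² + 2 Σ_{j,k=1}^n b^{jk} ℓ_{x_j} v_{x_k} v_t + Ψ v v_t − (Ψ_t/2) v² ) − Σ_{k=1}^n ∂_{x_k} ( Σ_{j=1}^n b^{jk} ℓ_{x_j} v_t² ) + [ ℓ_{tt} + Σ_{j,k=1}^n (b^{jk} ℓ_{x_j})_{x_k} − Ψ ] v_t² − 2 Σ_{j,k=1}^n (b^{jk} ℓ_{x_k})_t v_{x_j} v_t + (Ψ_{tt}/2) v². -/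
open scoped BigOperators

/-- Partial derivative in time (first component of `ℝ × ℝⁿ`). -/
noncomputable def pt {n : ℕ} (f : ℝ × (Fin n → ℝ) → ℝ) : ℝ × (Fin n → ℝ) → ℝ :=
  fun p => fderiv ℝ f p (1, 0)

/-- Partial derivative in the `j`-th spatial coordinate of `ℝ × ℝⁿ`. -/
noncomputable def px {n : ℕ} (j : Fin n) (f : ℝ × (Fin n → ℝ) → ℝ) : ℝ × (Fin n → ℝ) → ℝ :=
  fun p => fderiv ℝ f p (0, Pi.single j 1)

section helpers
variable {n : ℕ}

theorem aux_smooth {f : ℝ × (Fin n → ℝ) → ℝ} (hf : ContDiff ℝ (⊤ : ℕ∞) f)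
    (w : ℝ × (Fin n → ℝ)) : ContDiff ℝ (⊤ : ℕ∞) (fun p => fderiv ℝ f p w) :=
  (hf.fderiv_right (m := (⊤ : ℕ∞)) (by simp)).clm_apply contDiff_const

theorem aux_diff {f : ℝ × (Fin n → ℝ) → ℝ} (hf : ContDiff ℝ (⊤ : ℕ∞) f) :
    Differentiable ℝ f := hf.differentiable (by simp)

theorem aux_mul {f g : ℝ × (Fin n → ℝ) → ℝ} (hf : Differentiable ℝ f)
    (hg : Differentiable ℝ g) (p w : ℝ × (Fin n → ℝ)) :
    fderiv ℝ (fun q => f q * g q) p w = fderiv ℝ f p w * g p + f p * fderiv ℝ g p w := by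
  rw [fderiv_fun_mul (hf p) (hg p)]
  simp
  ring

theorem aux_symm {f : ℝ × (Fin n → ℝ) → ℝ} (hf : ContDiff ℝ (⊤ : ℕ∞) f)
    (p u w : ℝ × (Fin n → ℝ)) :
    fderiv ℝ (fun q => fderiv ℝ f q u) p w = fderiv ℝ (fun q => fderiv ℝ f q w) p u := by
  have hd : Differentiable ℝ (fderiv ℝ f) :=
    (hf.fderiv_right (m := (⊤ : ℕ∞)) (by simp)).differentiable (by simp)
  have h : ∀ a c, fderiv ℝ (fun q => fderiv ℝ f q a) p c = fderiv ℝ (fderiv ℝ f) p c a := by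
    intro a c
    rw [fderiv_clm_apply (hd p) (differentiableAt_const a)]
    simp
  rw [h, h]
  exact (hf.contDiffAt.isSymmSndFDerivAt (by
    simp only [minSmoothness_of_isRCLikeNormedField]; exact WithTop.coe_le_coe.2 (le_top : (2 : ℕ∞) ≤ ⊤))) w u

end helpers

/-- The deterministic (noise-free) version of identity (w1) in the proof of the
fundamental Carleman identity for stochastic hyperbolic-like operators. -/
theorem stmt4 (n : ℕ) (hn : 1 ≤ n)
    (b : Fin n → Fin n → ℝ × (Fin n → ℝ) → ℝ)
    (hb : ∀ j k, ContDiff ℝ (⊤ : ℕ∞) (b j k))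
    (hbsym : ∀ j k, b j k = b k j)
    (ℓ Ψ v : ℝ × (Fin n → ℝ) → ℝ)
    (hℓ : ContDiff ℝ (⊤ : ℕ∞) ℓ) (hΨ : ContDiff ℝ (⊤ : ℕ∞) Ψ) (hv : ContDiff ℝ (⊤ : ℕ∞) v) :
    ∀ p : ℝ × (Fin n → ℝ),
      (-2 * pt ℓ p * pt v p + 2 * (∑ j, ∑ k, b j k p * px j ℓ p * px k v p) + Ψ p * v p)
          * pt (pt v) p
        = pt (fun q => -(pt ℓ q) * pt v q ^ 2
              + 2 * (∑ j, ∑ k, b j k q * px j ℓ q * px k v q * pt v q)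
              + Ψ q * v q * pt v q - pt Ψ q / 2 * v q ^ 2) p
          - (∑ k, px k (fun q => ∑ j, b j k q * px j ℓ q * pt v q ^ 2) p)
          + (pt (pt ℓ) p + (∑ j, ∑ k, px k (fun q => b j k q * px j ℓ q) p) - Ψ p)
              * pt v p ^ 2
          - 2 * (∑ j, ∑ k, pt (fun q => b j k q * px k ℓ q) p * px j v p * pt v p)
          + pt (pt Ψ) p / 2 * v p ^ 2 := by
  intro p
  have hpt : ∀ {f : ℝ × (Fin n → ℝ) → ℝ}, ContDiff ℝ (⊤ : ℕ∞) f → ContDiff ℝ (⊤ : ℕ∞) (pt f) :=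
    fun hf => aux_smooth hf _
  have hpx : ∀ (j : Fin n) {f : ℝ × (Fin n → ℝ) → ℝ}, ContDiff ℝ (⊤ : ℕ∞) f →
      ContDiff ℝ (⊤ : ℕ∞) (px j f) := fun j _ hf => aux_smooth hf _
  have ptmul : ∀ {f g : ℝ × (Fin n → ℝ) → ℝ}, Differentiable ℝ f → Differentiable ℝ g →
      pt (fun q => f q * g q) p = pt f p * g p + f p * pt g p :=
    fun hf hg => aux_mul hf hg _ _
  have pxmul : ∀ (k : Fin n) {f g : ℝ × (Fin n → ℝ) → ℝ}, Differentiable ℝ f →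
      Differentiable ℝ g →
      px k (fun q => f q * g q) p = px k f p * g p + f p * px k g p :=
    fun k _ _ hf hg => aux_mul hf hg _ _
  have dv := aux_diff hv
  have dΨ := aux_diff hΨ
  have dvt := aux_diff (hpt hv)
  have dℓt := aux_diff (hpt hℓ)
  have dΨt := aux_diff (hpt hΨ)
  have dvx := fun k => aux_diff (hpx k hv)
  have dc : ∀ j k, Differentiable ℝ (fun q => b j k q * px j ℓ q) :=
    fun j k => (aux_diff (hb j k)).mul (aux_diff (hpx j hℓ))
  have sym : ∀ k, px k (pt v) p = pt (px k v) p := fun k => aux_symm hv p _ _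
  have dsq : Differentiable ℝ (fun q => pt v q * pt v q) := dvt.mul dvt
  have dΨv : Differentiable ℝ (fun q => Ψ q * v q) := dΨ.mul dv
  have dvv : Differentiable ℝ (fun q => v q * v q) := dv.mul dv
  have dcv : ∀ j k, Differentiable ℝ (fun q => b j k q * px j ℓ q * px k v q) :=
    fun j k => (dc j k).mul (dvx k)
  have dterm : ∀ j k, Differentiable ℝ
      (fun q => b j k q * px j ℓ q * px k v q * pt v q) :=
    fun j k => ((dc j k).mul (dvx k)).mul dvt
  have e1 : pt (fun q => -(pt ℓ q) * pt v q ^ 2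
              + 2 * (∑ j, ∑ k, b j k q * px j ℓ q * px k v q * pt v q)
              + Ψ q * v q * pt v q - pt Ψ q / 2 * v q ^ 2) p
      = -(pt (fun q => pt ℓ q * (pt v q * pt v q)) p)
        + 2 * (∑ j, ∑ k, pt (fun q => b j k q * px j ℓ q * px k v q * pt v q) p)
        + pt (fun q => Ψ q * v q * pt v q) p
        - 1 / 2 * pt (fun q => pt Ψ q * (v q * v q)) p := by
    have H1 := ((dℓt.mul dsq) p).hasFDerivAt
    have H2 := HasFDerivAt.fun_sum (u := Finset.univ) (fun j _ =>
      HasFDerivAt.fun_sum (u := Finset.univ) (fun k _ => (dterm j k p).hasFDerivAt))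
    have H3 := (((dΨ.mul dv).mul dvt) p).hasFDerivAt
    have H4 := ((dΨt.mul (dv.mul dv)) p).hasFDerivAt
    have H := ((H1.neg.add (H2.const_mul 2)).add H3).sub (H4.const_mul (1 / 2))
    have E := congrArg (fun L => L ((1 : ℝ), (0 : Fin n → ℝ))) H.fderiv
    simp only [pt] at E ⊢
    refine Eq.trans ?_ (E.trans ?_)
    · congr 2
      funext q
      simp [pt]
      ring
    · simp
      rfl
  have e2 : ∀ k, px k (fun q => ∑ j, b j k q * px j ℓ q * pt v q ^ 2) p
      = ∑ j, px k (fun q => b j k q * px j ℓ q * (pt v q * pt v q)) p := by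
    intro k
    have H := HasFDerivAt.fun_sum (u := Finset.univ)
      (fun j _ => (((dc j k).mul dsq) p).hasFDerivAt)
    have E := congrArg (fun L => L ((0 : ℝ), (Pi.single k 1 : Fin n → ℝ))) H.fderiv
    simp only [px] at E ⊢
    refine Eq.trans ?_ (E.trans ?_)
    · congr 2
      funext q
      simp [pow_two]
    · simp only [_root_.sum_apply]
      rfl
  have f2 : ∀ j k, pt (fun q => b j k q * px j ℓ q * px k v q * pt v q) p
      = (pt (fun q => b j k q * px j ℓ q) p * px k v p
          + b j k p * px j ℓ p * pt (px k v) p) * pt v p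
        + b j k p * px j ℓ p * px k v p * pt (pt v) p := by
    intro j k
    rw [ptmul (dcv j k) dvt, ptmul (dc j k) (dvx k)]
  have f3 : ∀ j k, px k (fun q => b j k q * px j ℓ q * (pt v q * pt v q)) p
      = px k (fun q => b j k q * px j ℓ q) p * pt v p ^ 2
        + 2 * (b j k p * px j ℓ p * pt (px k v) p * pt v p) := by
    intro j k
    rw [pxmul k (dc j k) dsq, pxmul k dvt dvt, sym]
    ring
  have f4 : (∑ j, ∑ k, pt (fun q => b j k q * px k ℓ q) p * px j v p * pt v p)
      = ∑ j, ∑ k, pt (fun q => b j k q * px j ℓ q) p * px k v p * pt v p := by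
    rw [Finset.sum_comm]
    refine Finset.sum_congr rfl fun j _ => Finset.sum_congr rfl fun k _ => ?_
    rw [hbsym k j]
  have g2 : (∑ j, ∑ k, pt (fun q => b j k q * px j ℓ q * px k v q * pt v q) p)
      = (∑ j, ∑ k, pt (fun q => b j k q * px j ℓ q) p * px k v p * pt v p)
        + (∑ j, ∑ k, b j k p * px j ℓ p * pt (px k v) p * pt v p)
        + (∑ j, ∑ k, b j k p * px j ℓ p * px k v p) * pt (pt v) p := by
    simp only [Finset.sum_mul, ← Finset.sum_add_distrib]
    refine Finset.sum_congr rfl fun j _ => Finset.sum_congr rfl fun k _ => ?_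
    rw [f2]
    ring
  have g3 : (∑ k, px k (fun q => ∑ j, b j k q * px j ℓ q * pt v q ^ 2) p)
      = (∑ j, ∑ k, px k (fun q => b j k q * px j ℓ q) p) * pt v p ^ 2
        + 2 * (∑ j, ∑ k, b j k p * px j ℓ p * pt (px k v) p * pt v p) := by
    simp only [e2]
    rw [Finset.sum_comm]
    simp only [f3, Finset.sum_mul, Finset.mul_sum, Finset.sum_add_distrib]
  rw [e1, g2, g3, f4, ptmul dℓt dsq, ptmul dvt dvt, ptmul dΨv dvt, ptmul dΨ dv,
    ptmul dΨt dvv, ptmul dv dv]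
  ring
end

section
/- Let n ∈ ℕ, n ≥ 1. Let b^{jk} : ℝ × ℝⁿ → ℝ (1 ≤ j,k ≤ n) be smooth with b^{jk} = b^{kj}, let ℓ, Ψ, z : ℝ × ℝⁿ → ℝ be smooth, set θ = e^ℓ, v = θ·z. Define c^{jk} := (b^{jk}ℓ_t)_t + Σ_{j',k'=1}^n [ 2b^{jk'}(b^{j'k}ℓ_{x_{j'}})_{x_{k'}} − (b^{jk}b^{j'k'}ℓ_{x_{j'}})_{x_{k'}} ] + Ψ b^{jk}, 𝒜 := (ℓ_t² − ℓ_{tt}) − Σ_{j,k=1}^n [ b^{jk}ℓ_{x_j}ℓ_{x_k} − (b^{jk}ℓ_{x_j})_{x_k} ] − Ψ, and ℬ := 𝒜Ψ + (𝒜ℓ_t)_t − Σ_{j,k=1}^n (𝒜 b^{jk}ℓ_{x_j})_{x_k} + (1/2)[ Ψ_{tt} − Σ_{j,k=1}^n (b^{jk}Ψ_{x_j})_{x_k} ]. Then at every point (t,x) ∈ ℝ × ℝⁿ the following identity holds: θ·( − 2ℓ_t v_t + 2Σ_{j,k=1}^n b^{jk}ℓ_{x_j}v_{x_k} + Ψ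 v )·( z_{tt} − Σ_{j,k=1}^n (b^{jk}z_{x_j})_{x_k} ) + Σ_{k=1}^n ∂_{x_k}[ Σ_{j=1}^n ( Σ_{j',k'=1}^n ( 2b^{jk}b^{j'k'}ℓ_{x_{j'}}v_{x_j}v_{x_{k'}} − b^{jk}b^{j'k'}ℓ_{x_j}v_{x_{j'}}v_{x_{k'}} ) − 2ℓ_t b^{jk}v_{x_j}v_t + b^{jk}ℓ_{x_j}v_t² + Ψ b^{jk}v_{x_j}v − (Ψ_{x_j}/2) b^{jk}v² − 𝒜 b^{jk}ℓ_{x_j}v² ) ] + ∂_t[ ℓ_t Σ_{j,k=1}^n b^{jk}v_{x_j}v_{x_k} + ℓ_t v_t² − 2Σ_{j,k=1}^n b^{jk}ℓ_{x_j}v_{x_k}v_t − Ψ v v_t + (𝒜ℓ_t + Ψ_t/2)v² ] = [ ℓ_{tt} + Σ_{j,k=1}^n (b^{jk}ℓ_{x_j})_{x_k} − Ψ ] v_t² + Σ_{j,k=1}^n c^{jk}v_{x_j}v_{x_k} − 2Σ_{j,k=1}^n [ (b^{jk}ℓ_{x_k})_t + b^{jk}ℓ_{t x_k} ] v_{x_j}v_t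 + ℬ v² + ( − 2ℓ_t v_t + 2Σ_{j,k=1}^n b^{jk}ℓ_{x_j}v_{x_k} + Ψ v )². -/
open scoped BigOperators

section helpers
variable {n : ℕ}

theorem cd_pt {f : ℝ × (Fin n → ℝ) → ℝ} (hf : ContDiff ℝ (⊤ : ℕ∞) f) :
    ContDiff ℝ (⊤ : ℕ∞) (pt f) := by
  unfold pt
  exact (hf.fderiv_right (m := (⊤ : ℕ∞)) (by simp)).clm_apply contDiff_const

theorem cd_px (j : Fin n) {f : ℝ × (Fin n → ℝ) → ℝ} (hf : ContDiff ℝ (⊤ : ℕ∞) f) :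
    ContDiff ℝ (⊤ : ℕ∞) (px j f) := by
  unfold px
  exact (hf.fderiv_right (m := (⊤ : ℕ∞)) (by simp)).clm_apply contDiff_const

theorem cd_da {f : ℝ × (Fin n → ℝ) → ℝ} (hf : ContDiff ℝ (⊤ : ℕ∞) f) (p) :
    DifferentiableAt ℝ f p := (hf.differentiable (by simp)) p

theorem dd_comm {f : ℝ × (Fin n → ℝ) → ℝ} (hf : ContDiff ℝ (⊤ : ℕ∞) f) (p u w) :
    fderiv ℝ (fun q => fderiv ℝ f q u) p w = fderiv ℝ (fun q => fderiv ℝ f q w) p u := by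
  have hd : DifferentiableAt ℝ (fderiv ℝ f) p :=
    ((hf.fderiv_right (m := (⊤ : ℕ∞)) (by simp)).differentiable (by simp)) p
  have hs : IsSymmSndFDerivAt ℝ f p := by
    apply (hf.contDiffAt).isSymmSndFDerivAt
    simp only [minSmoothness_of_isRCLikeNormedField]
    exact WithTop.coe_le_coe.2 (le_top : (2 : ℕ∞) ≤ ⊤)
  rw [fderiv_clm_apply hd (by fun_prop), fderiv_clm_apply hd (by fun_prop)]
  simpa using hs.eq w u

theorem pt_px (j : Fin n) {f : ℝ × (Fin n → ℝ) → ℝ} (hf : ContDiff ℝ (⊤ : ℕ∞) f) (p) :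
    pt (px j f) p = px j (pt f) p := dd_comm hf p _ _

theorem px_px (j k : Fin n) {f : ℝ × (Fin n → ℝ) → ℝ} (hf : ContDiff ℝ (⊤ : ℕ∞) f) (p) :
    px k (px j f) p = px j (px k f) p := dd_comm hf p _ _

theorem pt_add  {f g : ℝ × (Fin n → ℝ) → ℝ} (hf : ContDiff ℝ (⊤ : ℕ∞) f)
    (hg : ContDiff ℝ (⊤ : ℕ∞) g) (p) :
    pt (fun q => f q + g q) p = pt f p + pt g p := by
  simp only [pt]
  rw [fderiv_fun_add (cd_da hf p) (cd_da hg p)]; rfl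

theorem pt_sub  {f g : ℝ × (Fin n → ℝ) → ℝ} (hf : ContDiff ℝ (⊤ : ℕ∞) f)
    (hg : ContDiff ℝ (⊤ : ℕ∞) g) (p) :
    pt (fun q => f q - g q) p = pt f p - pt g p := by
  simp only [pt]
  rw [fderiv_fun_sub (cd_da hf p) (cd_da hg p)]; rfl

theorem pt_mul  {f g : ℝ × (Fin n → ℝ) → ℝ} (hf : ContDiff ℝ (⊤ : ℕ∞) f)
    (hg : ContDiff ℝ (⊤ : ℕ∞) g) (p) :
    pt (fun q => f q * g q) p = pt f p * g p + f p * pt g p := by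
  simp only [pt]
  rw [fderiv_fun_mul (cd_da hf p) (cd_da hg p)]
  simp; ring

theorem pt_sq  {f : ℝ × (Fin n → ℝ) → ℝ} (hf : ContDiff ℝ (⊤ : ℕ∞) f) (p) :
    pt (fun q => f q ^ 2) p = 2 * f p * pt f p := by
  simp only [pow_two]
  rw [pt_mul hf hf]; ring

theorem pt_const  (a : ℝ) (p) :
    pt (fun _ : ℝ × (Fin n → ℝ) => a) p = 0 := by
  simp [pt]

theorem pt_div2  {f : ℝ × (Fin n → ℝ) → ℝ} (hf : ContDiff ℝ (⊤ : ℕ∞) f) (p) :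
    pt (fun q => f q / 2) p = pt f p / 2 := by
  simp only [div_eq_mul_inv]
  rw [pt_mul hf contDiff_const, pt_const]; ring

theorem pt_sum  {f : Fin n → ℝ × (Fin n → ℝ) → ℝ}
    (hf : ∀ i, ContDiff ℝ (⊤ : ℕ∞) (f i)) (p) :
    pt (fun q => ∑ i, f i q) p = ∑ i, pt (f i) p := by
  simp only [pt]
  rw [fderiv_fun_sum (fun i _ => cd_da (hf i) p)]
  simp

theorem pt_exp  {f : ℝ × (Fin n → ℝ) → ℝ} (hf : ContDiff ℝ (⊤ : ℕ∞) f) (p) :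
    pt (fun q => Real.exp (f q)) p = Real.exp (f p) * pt f p := by
  simp only [pt]
  rw [fderiv_exp (cd_da hf p)]; simp

theorem px_add (k : Fin n) {f g : ℝ × (Fin n → ℝ) → ℝ} (hf : ContDiff ℝ (⊤ : ℕ∞) f)
    (hg : ContDiff ℝ (⊤ : ℕ∞) g) (p) :
    px k (fun q => f q + g q) p = px k f p + px k g p := by
  simp only [px]
  rw [fderiv_fun_add (cd_da hf p) (cd_da hg p)]; rfl

theorem px_sub (k : Fin n) {f g : ℝ × (Fin n → ℝ) → ℝ} (hf : ContDiff ℝ (⊤ : ℕ∞) f)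
    (hg : ContDiff ℝ (⊤ : ℕ∞) g) (p) :
    px k (fun q => f q - g q) p = px k f p - px k g p := by
  simp only [px]
  rw [fderiv_fun_sub (cd_da hf p) (cd_da hg p)]; rfl

theorem px_mul (k : Fin n) {f g : ℝ × (Fin n → ℝ) → ℝ} (hf : ContDiff ℝ (⊤ : ℕ∞) f)
    (hg : ContDiff ℝ (⊤ : ℕ∞) g) (p) :
    px k (fun q => f q * g q) p = px k f p * g p + f p * px k g p := by
  simp only [px]
  rw [fderiv_fun_mul (cd_da hf p) (cd_da hg p)]
  simp; ring

theorem px_sq (k : Fin n) {f : ℝ × (Fin n → ℝ) → ℝ} (hf : ContDiff ℝ (⊤ : ℕ∞) f) (p) :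
    px k (fun q => f q ^ 2) p = 2 * f p * px k f p := by
  simp only [pow_two]
  rw [px_mul k hf hf]; ring

theorem px_const (k : Fin n) (a : ℝ) (p) :
    px k (fun _ : ℝ × (Fin n → ℝ) => a) p = 0 := by
  simp [px]

theorem px_div2 (k : Fin n) {f : ℝ × (Fin n → ℝ) → ℝ} (hf : ContDiff ℝ (⊤ : ℕ∞) f) (p) :
    px k (fun q => f q / 2) p = px k f p / 2 := by
  simp only [div_eq_mul_inv]
  rw [px_mul k hf contDiff_const, px_const]; ring

theorem px_sum (k : Fin n) {f : Fin n → ℝ × (Fin n → ℝ) → ℝ}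
    (hf : ∀ i, ContDiff ℝ (⊤ : ℕ∞) (f i)) (p) :
    px k (fun q => ∑ i, f i q) p = ∑ i, px k (f i) p := by
  simp only [px]
  rw [fderiv_fun_sum (fun i _ => cd_da (hf i) p)]
  simp

theorem px_exp (k : Fin n) {f : ℝ × (Fin n → ℝ) → ℝ} (hf : ContDiff ℝ (⊤ : ℕ∞) f) (p) :
    px k (fun q => Real.exp (f q)) p = Real.exp (f p) * px k f p := by
  simp only [px]
  rw [fderiv_exp (cd_da hf p)]; simp

theorem sum2_swap (F : Fin n → Fin n → ℝ) : ∑ j, ∑ k, F j k = ∑ j, ∑ k, F k j :=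
  Finset.sum_comm

theorem sum2_antisymm (F : Fin n → Fin n → ℝ) (h : ∀ j k, F j k = - F k j) :
    ∑ j, ∑ k, F j k = 0 := by
  have h1 := sum2_swap F
  have h2 : ∑ j, ∑ k, F j k = - ∑ j, ∑ k, F k j := by
    simp only [← Finset.sum_neg_distrib]
    exact Finset.sum_congr rfl fun j _ => Finset.sum_congr rfl fun k _ => h j k
  linarith

theorem sum2_congr {F G : Fin n → Fin n → ℝ} (h : ∀ j k, F j k = G j k) :
    ∑ j, ∑ k, F j k = ∑ j, ∑ k, G j k :=
  Finset.sum_congr rfl fun j _ => Finset.sum_congr rfl fun k _ => h j k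

theorem sum4_swap (F : Fin n → Fin n → Fin n → Fin n → ℝ) :
    ∑ j, ∑ k, ∑ j', ∑ k', F j k j' k' = ∑ j, ∑ k, ∑ j', ∑ k', F j' k' j k := by
  simp only [← Fintype.sum_prod_type']
  have := Finset.sum_comm (s := (Finset.univ : Finset (Fin n × Fin n)))
    (t := (Finset.univ : Finset (Fin n × Fin n))) (f := fun a b => F a.1 a.2 b.1 b.2)
  simpa only [Fintype.sum_prod_type] using this

theorem sum4_swap_k (F : Fin n → Fin n → Fin n → Fin n → ℝ) :
    ∑ j, ∑ k, ∑ j', ∑ k', F j k j' k' = ∑ j, ∑ k, ∑ j', ∑ k', F j k' j' k := by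
  refine Finset.sum_congr rfl fun j _ => ?_
  rw [Finset.sum_comm]
  conv_rhs => rw [Finset.sum_comm]
  exact Finset.sum_congr rfl fun j' _ => Finset.sum_comm

theorem sum4_congr {F G : Fin n → Fin n → Fin n → Fin n → ℝ}
    (h : ∀ j k j' k', F j k j' k' = G j k j' k') :
    ∑ j, ∑ k, ∑ j', ∑ k', F j k j' k' = ∑ j, ∑ k, ∑ j', ∑ k', G j k j' k' :=
  sum2_congr fun j k => sum2_congr fun j' k' => h j k j' k'

end helpers

/-- The fundamental pointwise identity for hyperbolic-like operators (Lemma 6.1 of the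
paper) in the deterministic case (diffusion term `Z = 0`, `v̂ = v_t`), upon which the
global Carleman estimate is built. -/
theorem stmt6 (n : ℕ) (hn : 1 ≤ n)
    (b : Fin n → Fin n → ℝ × (Fin n → ℝ) → ℝ)
    (hb : ∀ j k, ContDiff ℝ (⊤ : ℕ∞) (b j k))
    (hbsym : ∀ j k, b j k = b k j)
    (ℓ Ψ z : ℝ × (Fin n → ℝ) → ℝ)
    (hℓ : ContDiff ℝ (⊤ : ℕ∞) ℓ) (hΨ : ContDiff ℝ (⊤ : ℕ∞) Ψ) (hz : ContDiff ℝ (⊤ : ℕ∞) z)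
    (θ v : ℝ × (Fin n → ℝ) → ℝ)
    (hθ : θ = fun p => Real.exp (ℓ p))
    (hv : v = fun p => θ p * z p)
    (c : Fin n → Fin n → ℝ × (Fin n → ℝ) → ℝ)
    (hc : ∀ j k, c j k = fun p =>
      pt (fun q => b j k q * pt ℓ q) p
      + (∑ j', ∑ k',
          (2 * b j k' p * px k' (fun q => b j' k q * px j' ℓ q) p
            - px k' (fun q => b j k q * b j' k' q * px j' ℓ q) p))
      + Ψ p * b j k p)
    (A : ℝ × (Fin n → ℝ) → ℝ)
    (hA : A = fun p =>
      (pt ℓ p ^ 2 - pt (pt ℓ) p)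
      - (∑ j, ∑ k, (b j k p * px j ℓ p * px k ℓ p
          - px k (fun q => b j k q * px j ℓ q) p))
      - Ψ p)
    (B : ℝ × (Fin n → ℝ) → ℝ)
    (hB : B = fun p =>
      A p * Ψ p + pt (fun q => A q * pt ℓ q) p
      - (∑ j, ∑ k, px k (fun q => A q * b j k q * px j ℓ q) p)
      + (1/2) * (pt (pt Ψ) p - ∑ j, ∑ k, px k (fun q => b j k q * px j Ψ q) p)) :
    ∀ p : ℝ × (Fin n → ℝ),
      θ p * (-2 * pt ℓ p * pt v p + 2 * (∑ j, ∑ k, b j k p * px j ℓ p * px k v p) + Ψ p * v p)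
          * (pt (pt z) p - ∑ j, ∑ k, px k (fun q => b j k q * px j z q) p)
      + (∑ k, px k (fun q => ∑ j,
          ((∑ j', ∑ k',
              (2 * b j k q * b j' k' q * px j' ℓ q * px j v q * px k' v q
                - b j k q * b j' k' q * px j ℓ q * px j' v q * px k' v q))
            - 2 * pt ℓ q * b j k q * px j v q * pt v q
            + b j k q * px j ℓ q * pt v q ^ 2
            + Ψ q * b j k q * px j v q * v q
            - px j Ψ q / 2 * b j k q * v q ^ 2
            - A q * b j k q * px j ℓ q * v q ^ 2)) p)
      + pt (fun q =>
          pt ℓ q * (∑ j, ∑ k, b j k q * px j v q * px k v q)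
          + pt ℓ q * pt v q ^ 2
          - 2 * (∑ j, ∑ k, b j k q * px j ℓ q * px k v q * pt v q)
          - Ψ q * v q * pt v q
          + (A q * pt ℓ q + pt Ψ q / 2) * v q ^ 2) p
      = (pt (pt ℓ) p + (∑ j, ∑ k, px k (fun q => b j k q * px j ℓ q) p) - Ψ p) * pt v p ^ 2
        + (∑ j, ∑ k, c j k p * px j v p * px k v p)
        - 2 * (∑ j, ∑ k,
            (pt (fun q => b j k q * px k ℓ q) p + b j k p * px k (pt ℓ) p)
              * px j v p * pt v p)
        + B p * v p ^ 2
        + (-2 * pt ℓ p * pt v p + 2 * (∑ j, ∑ k, b j k p * px j ℓ p * px k v p)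
            + Ψ p * v p) ^ 2 := by
  intro p
  have hθs : ContDiff ℝ (⊤ : ℕ∞) θ := by rw [hθ]; exact hℓ.exp
  have hvs : ContDiff ℝ (⊤ : ℕ∞) v := by rw [hv]; exact hθs.mul hz
  have hℓt := cd_pt hℓ
  have hℓx := fun j => cd_px j hℓ
  have hvt := cd_pt hvs
  have hvx := fun j => cd_px j hvs
  have hzt := cd_pt hz
  have hzx := fun j => cd_px j hz
  have hΨt := cd_pt hΨ
  have hΨx := fun j => cd_px j hΨ
  have hℓtt := cd_pt hℓt
  have hbℓ : ∀ j k, ContDiff ℝ (⊤ : ℕ∞) (px k (fun q => b j k q * px j ℓ q)) :=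
    fun j k => cd_px k ((hb j k).mul (hℓx j))
  have hAs : ContDiff ℝ (⊤ : ℕ∞) A := by rw [hA]; fun_prop
  have hθt : ∀ q, pt θ q = θ q * pt ℓ q := by
    intro q; rw [hθ]; exact pt_exp hℓ q
  have hθx : ∀ k q, px k θ q = θ q * px k ℓ q := by
    intro k q; rw [hθ]; exact px_exp k hℓ q
  -- conjugation by the weight
  have hztv : (fun q => θ q * pt z q) = fun q => pt v q - pt ℓ q * v q := by
    funext q
    have : pt v q = pt θ q * z q + θ q * pt z q := by
      conv_lhs => rw [hv]
      exact pt_mul hθs hz q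
    rw [this, hθt, congrFun hv q]; ring
  have hzxv : ∀ j, ∀ q, θ q * px j z q = px j v q - px j ℓ q * v q := by
    intro j q
    have : px j v q = px j θ q * z q + θ q * px j z q := by
      conv_lhs => rw [hv]
      exact px_mul j hθs hz q
    rw [this, hθx, congrFun hv q]; ring
  have hztt : θ p * pt (pt z) p = pt (pt v) p - 2 * pt ℓ p * pt v p
      + (pt ℓ p ^ 2 - pt (pt ℓ) p) * v p := by
    have h1 := congrArg (fun f => pt f p) hztv
    have h2 := congrFun hztv p
    simp (disch := fun_prop) only [pt_mul, pt_sub, hθt] at h1 h2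
    linear_combination h1 - pt ℓ p * h2
  have hzxx : ∀ j k, θ p * px k (fun q => b j k q * px j z q) p
      = px k (fun q => b j k q * px j v q) p - b j k p * px j ℓ p * px k v p
        - b j k p * px k ℓ p * px j v p + (b j k p * px j ℓ p * px k ℓ p
          - px k (fun q => b j k q * px j ℓ q) p) * v p := by
    intro j k
    have h0 : (fun q => θ q * (b j k q * px j z q))
        = fun q => b j k q * px j v q - b j k q * px j ℓ q * v q := by
      funext q
      linear_combination b j k q * hzxv j q
    have h1 := congrArg (fun f => px k f p) h0
    have h2 := congrFun h0 p
    simp (disch := fun_prop) only [px_mul, px_sub, hθx] at h1 h2 ⊢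
    linear_combination h1 - px k ℓ p * h2
  have hsw : ∑ j, ∑ k, b j k p * px k ℓ p * px j v p
      = ∑ j, ∑ k, b j k p * px j ℓ p * px k v p := by
    rw [sum2_swap]
    exact sum2_congr fun j k => by rw [hbsym]
  have hop : θ p * (pt (pt z) p - ∑ j, ∑ k, px k (fun q => b j k q * px j z q) p)
      = pt (pt v) p - (∑ j, ∑ k, px k (fun q => b j k q * px j v q) p) + A p * v p
        + (-2 * pt ℓ p * pt v p + 2 * (∑ j, ∑ k, b j k p * px j ℓ p * px k v p)
            + Ψ p * v p) := by
    have h1 : θ p * (∑ j, ∑ k, px k (fun q => b j k q * px j z q) p)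
        = ∑ j, ∑ k, (px k (fun q => b j k q * px j v q) p - b j k p * px j ℓ p * px k v p
        - b j k p * px k ℓ p * px j v p + (b j k p * px j ℓ p * px k ℓ p
          - px k (fun q => b j k q * px j ℓ q) p) * v p) := by
      simp only [Finset.mul_sum]
      exact sum2_congr hzxx
    simp only [Finset.sum_add_distrib, Finset.sum_sub_distrib, hsw] at h1
    simp only [← Finset.sum_mul, Finset.sum_sub_distrib] at h1
    rw [mul_sub, hztt, h1, congrFun hA p]
    simp only [Finset.sum_sub_distrib]
    ring
  -- expansion of the fluxes
  have hfx : (∑ k, px k (fun q => ∑ j,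
          ((∑ j', ∑ k',
              (2 * b j k q * b j' k' q * px j' ℓ q * px j v q * px k' v q
                - b j k q * b j' k' q * px j ℓ q * px j' v q * px k' v q))
            - 2 * pt ℓ q * b j k q * px j v q * pt v q
            + b j k q * px j ℓ q * pt v q ^ 2
            + Ψ q * b j k q * px j v q * v q
            - px j Ψ q / 2 * b j k q * v q ^ 2
            - A q * b j k q * px j ℓ q * v q ^ 2)) p)
      = (∑ j, ∑ k, ∑ j', ∑ k',
          px k (fun q => 2 * b j k q * b j' k' q * px j' ℓ q * px j v q * px k' v q) p)
        - (∑ j, ∑ k, ∑ j', ∑ k',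
          px k (fun q => b j k q * b j' k' q * px j ℓ q * px j' v q * px k' v q) p)
        - (∑ j, ∑ k, px k (fun q => 2 * pt ℓ q * b j k q * px j v q * pt v q) p)
        + (∑ j, ∑ k, px k (fun q => b j k q * px j ℓ q * pt v q ^ 2) p)
        + (∑ j, ∑ k, px k (fun q => Ψ q * b j k q * px j v q * v q) p)
        - (∑ j, ∑ k, px k (fun q => px j Ψ q / 2 * b j k q * v q ^ 2) p)
        - (∑ j, ∑ k, px k (fun q => A q * b j k q * px j ℓ q * v q ^ 2) p) := by
    simp only [← Finset.sum_add_distrib, ← Finset.sum_sub_distrib]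
    rw [Finset.sum_comm]
    refine Finset.sum_congr rfl fun k _ => ?_
    rw [px_sum k (by intro j; fun_prop)]
    refine Finset.sum_congr rfl fun j _ => ?_
    rw [px_sub k (by fun_prop) (by fun_prop), px_sub k (by fun_prop) (by fun_prop),
      px_add k (by fun_prop) (by fun_prop), px_add k (by fun_prop) (by fun_prop),
      px_sub k (by fun_prop) (by fun_prop), px_sum k (by intro j; fun_prop)]
    congr 5
    refine Finset.sum_congr rfl fun j' _ => ?_
    rw [px_sum k (by intro j; fun_prop)]
    refine Finset.sum_congr rfl fun k' _ => ?_
    rw [px_sub k (by fun_prop) (by fun_prop)]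
  have hft : pt (fun q =>
          pt ℓ q * (∑ j, ∑ k, b j k q * px j v q * px k v q)
          + pt ℓ q * pt v q ^ 2
          - 2 * (∑ j, ∑ k, b j k q * px j ℓ q * px k v q * pt v q)
          - Ψ q * v q * pt v q
          + (A q * pt ℓ q + pt Ψ q / 2) * v q ^ 2) p
      = (∑ j, ∑ k, pt (fun q => pt ℓ q * (b j k q * px j v q * px k v q)) p)
        + pt (fun q => pt ℓ q * pt v q ^ 2) p
        - 2 * (∑ j, ∑ k, pt (fun q => b j k q * px j ℓ q * px k v q * pt v q) p)
        - pt (fun q => Ψ q * v q * pt v q) p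
        + pt (fun q => (A q * pt ℓ q + pt Ψ q / 2) * v q ^ 2) p := by
    rw [pt_add (by fun_prop) (by fun_prop), pt_sub (by fun_prop) (by fun_prop),
      pt_sub (by fun_prop) (by fun_prop), pt_add (by fun_prop) (by fun_prop)]
    simp only [Finset.mul_sum]
    congr 4
    · rw [pt_sum (by intro j; fun_prop)]
      refine Finset.sum_congr rfl fun j' _ => ?_
      rw [pt_sum (by intro j; fun_prop)]
    · rw [pt_sum (by intro j; fun_prop)]
      refine Finset.sum_congr rfl fun j' _ => ?_
      rw [pt_sum (by intro j; fun_prop)]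
      refine Finset.sum_congr rfl fun k' _ => ?_
      rw [pt_mul (by fun_prop) (by fun_prop), pt_const]
      ring
  -- the individual products
  have e1 : pt (pt v) p * (-2 * pt ℓ p * pt v p) + pt (fun q => pt ℓ q * pt v q ^ 2) p
      = pt (pt ℓ) p * pt v p ^ 2 := by
    simp (disch := fun_prop) only [pt_mul, pt_sq]
    ring
  have e1' : pt (pt v) p * (Ψ p * v p) - pt (fun q => Ψ q * v q * pt v q) p
      + A p * v p * (-2 * pt ℓ p * pt v p)
      + pt (fun q => (A q * pt ℓ q + pt Ψ q / 2) * v q ^ 2) p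
      = - Ψ p * pt v p ^ 2 + 1 / 2 * pt (pt Ψ) p * v p ^ 2
        + pt (fun q => A q * pt ℓ q) p * v p ^ 2 := by
    simp (disch := fun_prop) only [pt_mul, pt_sq, pt_add, pt_div2]
    ring
  have e2 : pt (pt v) p * (2 * (∑ j, ∑ k, b j k p * px j ℓ p * px k v p))
      + (∑ j, ∑ k, px k (fun q => b j k q * px j ℓ q * pt v q ^ 2) p)
      - 2 * (∑ j, ∑ k, pt (fun q => b j k q * px j ℓ q * px k v q * pt v q) p)
      = (∑ j, ∑ k, px k (fun q => b j k q * px j ℓ q) p) * pt v p ^ 2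
        - 2 * (∑ j, ∑ k, pt (fun q => b j k q * px k ℓ q) p * px j v p * pt v p) := by
    rw [sum2_swap fun j k => pt (fun q => b j k q * px k ℓ q) p * px j v p * pt v p]
    simp only [Finset.mul_sum, Finset.sum_mul, ← Finset.sum_add_distrib,
      ← Finset.sum_sub_distrib]
    refine sum2_congr fun j k => ?_
    rw [hbsym k j]
    simp (disch := fun_prop) only [pt_mul, px_mul, px_sq, pt_px k hvs]
    ring
  have r3 : ∑ j, ∑ k, pt ℓ p * b j k p
      * (px k v p * px j (pt v) p - px j v p * px k (pt v) p) = 0 :=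
    sum2_antisymm _ fun j k => by rw [hbsym]; ring
  have e3 : -(∑ j, ∑ k, px k (fun q => b j k q * px j v q) p) * (-2 * pt ℓ p * pt v p)
      - (∑ j, ∑ k, px k (fun q => 2 * pt ℓ q * b j k q * px j v q * pt v q) p)
      + (∑ j, ∑ k, pt (fun q => pt ℓ q * (b j k q * px j v q * px k v q)) p)
      = - 2 * (∑ j, ∑ k, b j k p * px k (pt ℓ) p * px j v p * pt v p)
        + (∑ j, ∑ k, pt (fun q => b j k q * pt ℓ q) p * px j v p * px k v p) := by
    rw [← add_zero (-2 * _ + _), ← r3]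
    simp only [Finset.mul_sum, Finset.sum_mul, ← Finset.sum_add_distrib,
      ← Finset.sum_sub_distrib, ← Finset.sum_neg_distrib]
    refine sum2_congr fun j k => ?_
    simp (disch := fun_prop) only [pt_mul, px_mul, px_const, pt_px _ hvs]
    ring
  have r4 : ∑ j, ∑ k, b j k p * v p
      * (px k Ψ p * px j v p - px j Ψ p * px k v p) = 0 :=
    sum2_antisymm _ fun j k => by rw [hbsym]; ring
  have e4 : -(∑ j, ∑ k, px k (fun q => b j k q * px j v q) p) * (Ψ p * v p)
      + (∑ j, ∑ k, px k (fun q => Ψ q * b j k q * px j v q * v q) p)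
      - (∑ j, ∑ k, px k (fun q => px j Ψ q / 2 * b j k q * v q ^ 2) p)
      = (∑ j, ∑ k, Ψ p * b j k p * px j v p * px k v p)
        - 1 / 2 * (∑ j, ∑ k, px k (fun q => b j k q * px j Ψ q) p) * v p ^ 2 := by
    rw [← add_zero (_ - 1 / 2 * _ * _), ← r4]
    simp only [Finset.mul_sum, Finset.sum_mul, ← Finset.sum_add_distrib,
      ← Finset.sum_sub_distrib, ← Finset.sum_neg_distrib]
    refine sum2_congr fun j k => ?_
    simp (disch := fun_prop) only [px_mul, px_sq, px_div2]
    ring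
  have e5 : A p * v p * (2 * (∑ j, ∑ k, b j k p * px j ℓ p * px k v p))
      - (∑ j, ∑ k, px k (fun q => A q * b j k q * px j ℓ q * v q ^ 2) p)
      = - (∑ j, ∑ k, px k (fun q => A q * b j k q * px j ℓ q) p) * v p ^ 2 := by
    simp only [Finset.mul_sum, Finset.sum_mul, ← Finset.sum_add_distrib,
      ← Finset.sum_sub_distrib, ← Finset.sum_neg_distrib]
    refine sum2_congr fun j k => ?_
    simp (disch := fun_prop) only [px_mul, px_sq]
    ring
  have hDS : (∑ j, ∑ k, px k (fun q => b j k q * px j v q) p)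
      * (∑ j, ∑ k, b j k p * px j ℓ p * px k v p)
      = ∑ j, ∑ k, ∑ j', ∑ k', px k (fun q => b j k q * px j v q) p
        * (b j' k' p * px j' ℓ p * px k' v p) := by
    simp_rw [Finset.sum_mul]
    simp_rw [Finset.mul_sum]
  have r6 : ∑ j, ∑ k, ∑ j', ∑ k', b j' k' p * px j' ℓ p * b j k p
      * (px j v p * px k' (px k v) p - px k v p * px k' (px j v) p) = 0 := by
    refine sum2_antisymm _ fun j k => ?_
    simp only [← Finset.sum_neg_distrib]
    refine sum2_congr fun j' k' => ?_
    rw [hbsym j k]; ring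
  have e6 : -2 * ((∑ j, ∑ k, px k (fun q => b j k q * px j v q) p)
      * (∑ j, ∑ k, b j k p * px j ℓ p * px k v p))
      + (∑ j, ∑ k, ∑ j', ∑ k',
          px k (fun q => 2 * b j k q * b j' k' q * px j' ℓ q * px j v q * px k' v q) p)
        - (∑ j, ∑ k, ∑ j', ∑ k',
          px k (fun q => b j k q * b j' k' q * px j ℓ q * px j' v q * px k' v q) p)
      = (∑ j, ∑ k, ∑ j', ∑ k', 2 * b j k' p * px k' (fun q => b j' k q * px j' ℓ q) p
          * px j v p * px k v p)
        - (∑ j, ∑ k, ∑ j', ∑ k', px k' (fun q => b j k q * b j' k' q * px j' ℓ q) p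
          * px j v p * px k v p) := by
    rw [hDS, sum4_swap_k fun j k j' k' =>
        2 * b j k' p * px k' (fun q => b j' k q * px j' ℓ q) p * px j v p * px k v p,
      sum4_swap fun j k j' k' =>
        px k (fun q => b j k q * b j' k' q * px j ℓ q * px j' v q * px k' v q) p,
      ← sub_zero (_ - _), ← r6]
    rw [← sub_eq_zero]
    simp only [Finset.mul_sum, ← Finset.sum_add_distrib,
      ← Finset.sum_sub_distrib]
    refine (sum4_congr (G := fun _ _ _ _ => 0) fun j k j' k' => ?_).trans (by simp)
    simp (disch := fun_prop) only [px_mul, px_const, px_px k' k hvs]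
    ring
  have hcs : (∑ j, ∑ k, c j k p * px j v p * px k v p)
      = (∑ j, ∑ k, pt (fun q => b j k q * pt ℓ q) p * px j v p * px k v p)
        + ((∑ j, ∑ k, ∑ j', ∑ k', 2 * b j k' p * px k' (fun q => b j' k q * px j' ℓ q) p
          * px j v p * px k v p)
        - (∑ j, ∑ k, ∑ j', ∑ k', px k' (fun q => b j k q * b j' k' q * px j' ℓ q) p
          * px j v p * px k v p))
        + (∑ j, ∑ k, Ψ p * b j k p * px j v p * px k v p) := by
    simp only [← Finset.sum_add_distrib, ← Finset.sum_sub_distrib]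
    refine sum2_congr fun j k => ?_
    rw [congrFun (hc j k) p]
    simp only [add_mul, Finset.sum_mul, sub_mul]
  have hms : (∑ j, ∑ k,
            (pt (fun q => b j k q * px k ℓ q) p + b j k p * px k (pt ℓ) p)
              * px j v p * pt v p)
      = (∑ j, ∑ k, pt (fun q => b j k q * px k ℓ q) p * px j v p * pt v p)
        + (∑ j, ∑ k, b j k p * px k (pt ℓ) p * px j v p * pt v p) := by
    simp only [← Finset.sum_add_distrib]
    exact sum2_congr fun j k => by ring
  rw [hfx, hft, hcs, hms, congrFun hB p]
  linear_combination (-2 * pt ℓ p * pt v p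
    + 2 * (∑ j, ∑ k, b j k p * px j ℓ p * px k v p) + Ψ p * v p) * hop
    + e1 + e1' + e2 + e3 + e4 + e5 + e6
end
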